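/- arXiv:2205.02013 — 2 statements merged into one kernel-verified Lean document; each statement's English description precedes it below -/
import Mathlib

section
/- The real span of the six Lagrange basis functions φ₁,…,φ₆, where φ(x₁,x₂,x₃) = (1 + 3x₁ + 2x₁² − x₂² − x₃²)/6 and φ₁(x)=φ(x₁,x₂,x₃), φ₂(x)=φ(−x₁,x₂,x₃), φ₃(x)=φ(x₂,x₁,x₃), φ₄(x)=φ(−x₂,x₁,x₃), φ₅(x)=φ(x₃,x₁,x₂), φ₆(x)=φ(−x₃,x₁,x₂), equals the space V(K̂) = span(1, x₁, x₂, x₃, x₁²−x₂², x₂²−x₃²). -/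
noncomputable section

/-- `φ(x₁,x₂,x₃) = (1 + 3x₁ + 2x₁² − x₂² − x₃²)/6`. -/
def phi (y1 y2 y3 : ℝ) : ℝ := (1 + 3 * y1 + 2 * y1 ^ 2 - y2 ^ 2 - y3 ^ 2) / 6

/-- The six Lagrange basis functions obtained from `φ` by coordinate substitutions. -/
def phis : Fin 6 → ((Fin 3 → ℝ) → ℝ) :=
  ![fun x => phi (x 0) (x 1) (x 2), fun x => phi (-x 0) (x 1) (x 2),
    fun x => phi (x 1) (x 0) (x 2), fun x => phi (-x 1) (x 0) (x 2),
    fun x => phi (x 2) (x 0) (x 1), fun x => phi (-x 2) (x 0) (x 1)]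

/-- The six spanning functions `1, x₁, x₂, x₃, x₁²-x₂², x₂²-x₃²` of `V(K̂)`. -/
def basisFuns : Fin 6 → ((Fin 3 → ℝ) → ℝ) :=
  ![fun _ => 1, fun x => x 0, fun x => x 1, fun x => x 2,
    fun x => x 0 ^ 2 - x 1 ^ 2, fun x => x 1 ^ 2 - x 2 ^ 2]

/-- The span of a finite family lies in the span of another one as soon as every member of the first
is a linear combination, with coefficients given by a matrix, of the members of the second. -/
theorem span_range_le_of_eq_sum {ι κ R M : Type*} [Semiring R] [AddCommMonoid M] [Module R M]
    [Fintype κ] {v : ι → M} {w : κ → M} (A : ι → κ → R) (h : ∀ i, v i = ∑ j, A i j • w j) :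
    Submodule.span R (Set.range v) ≤ Submodule.span R (Set.range w) := by
  rw [Submodule.span_le, Set.range_subset_iff]
  exact fun i => Submodule.mem_span_range_iff_exists_fun R |>.2 ⟨A i, (h i).symm⟩

/-- The span of the six Lagrange basis functions `φ₁,…,φ₆` equals
`V(K̂) = span(1, x₁, x₂, x₃, x₁²−x₂², x₂²−x₃²)`. -/
theorem span_lagrange_eq_VK :
    Submodule.span ℝ (Set.range phis) = Submodule.span ℝ (Set.range basisFuns) := by
  apply le_antisymm
  · refine span_range_le_of_eq_sum
      ![![1/6, 1/2, 0, 0, 1/3, 1/6], ![1/6, -1/2, 0, 0, 1/3, 1/6],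
        ![1/6, 0, 1/2, 0, -1/6, 1/6], ![1/6, 0, -1/2, 0, -1/6, 1/6],
        ![1/6, 0, 0, 1/2, -1/6, -1/3], ![1/6, 0, 0, -1/2, -1/6, -1/3]] fun i => ?_
    ext x
    fin_cases i <;> simp [phis, basisFuns, phi, Fin.sum_univ_succ] <;> ring
  · refine span_range_le_of_eq_sum
      ![![1, 1, 1, 1, 1, 1], ![1, -1, 0, 0, 0, 0], ![0, 0, 1, -1, 0, 0], ![0, 0, 0, 0, 1, -1],
        ![1, 1, -1, -1, 0, 0], ![0, 0, 1, 1, -1, -1]] fun i => ?_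
    ext x
    fin_cases i <;> simp [phis, basisFuns, phi, Fin.sum_univ_succ] <;> ring

end
end

section
/- Edge-midpoint quadrature on a tetrahedron is exact for rotated-Q₁ functions: let T̂ ⊂ ℝ³ be the tetrahedron with vertices (1,1,1), (1,−1,−1), (−1,1,−1), (−1,−1,1), whose six edge midpoints are x₁,…,x₆ = (±1,0,0),(0,±1,0),(0,0,±1), let F(x̂) = Ax̂ + c with A ∈ ℝ³ˣ³ invertible and c ∈ ℝ³, and let T = F(T̂). Then for every function w : ℝ³ → ℝ such that w∘F belongs to V(K̂) = span(1, x₁, x₂, x₃, x₁²−x₂², x₂²−x₃²), one has ∫_T w dλ = (|T|/6) Σᵢ₌₁⁶ w(F(xᵢ)), where λ is three-dimensional Lebesgue measure and |T| = λ(T) = |det A|·(8/3). -/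
open MeasureTheory

noncomputable section

/-- The six face midpoints of the reference cube `[-1,1]^3`, which are the edge midpoints
of the reference tetrahedron. -/
def pts : Fin 6 → (Fin 3 → ℝ) :=
  ![![1,0,0], ![-1,0,0], ![0,1,0], ![0,-1,0], ![0,0,1], ![0,0,-1]]

/-- The rotated `Q₁` space `V(K̂)`. -/
def VK : Submodule ℝ ((Fin 3 → ℝ) → ℝ) := Submodule.span ℝ (Set.range basisFuns)

/-- The vertices of the reference tetrahedron `T̂`. -/
def tverts : Fin 4 → (Fin 3 → ℝ) :=
  ![![1,1,1], ![1,-1,-1], ![-1,1,-1], ![-1,-1,1]]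

/-- The reference tetrahedron `T̂`. -/
def Tref : Set (Fin 3 → ℝ) := convexHull ℝ (Set.range tverts)

theorem setIntegral_image_mulVec_add {n : Type*} [Fintype n] [DecidableEq n]
    (A : Matrix n n ℝ) (hA : IsUnit A.det) (c : n → ℝ) {s : Set (n → ℝ)}
    (hs : MeasurableSet s) (f : (n → ℝ) → ℝ) :
    ∫ x in (fun x => A.mulVec x + c) '' s, f x = |A.det| * ∫ x in s, f (A.mulVec x + c) := by
  have hderiv (x : n → ℝ) : HasFDerivAt (fun x => A.mulVec x + c)
      (LinearMap.toContinuousLinearMap (Matrix.toLin' A)) x :=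
    (LinearMap.toContinuousLinearMap (Matrix.toLin' A)).hasFDerivAt.add_const c
  have hinj : Function.Injective (fun x => A.mulVec x + c) := fun x y h =>
    Matrix.mulVec_injective_iff_isUnit.2 ((Matrix.isUnit_iff_isUnit_det A).2 hA)
      (add_right_cancel h)
  rw [integral_image_eq_integral_abs_det_fderiv_smul volume hs
    (fun x _ => (hderiv x).hasFDerivWithinAt) hinj.injOn f]
  simp only [smul_eq_mul, integral_const_mul, ContinuousLinearMap.det,
    LinearMap.coe_toContinuousLinearMap, LinearMap.det_toLin']

theorem volume_image_mulVec_add {n : Type*} [Fintype n] [DecidableEq n]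
    (A : Matrix n n ℝ) (c : n → ℝ) (s : Set (n → ℝ)) :
    volume ((fun x => A.mulVec x + c) '' s) = ENNReal.ofReal |A.det| * volume s := by
  have h : (fun x => A.mulVec x + c) '' s = (fun x => x + c) '' (Matrix.toLin' A '' s) := by
    rw [Set.image_image]; rfl
  rw [h, Set.image_add_right, measure_preimage_add_right, Measure.addHaar_image_linearMap,
    LinearMap.det_toLin']

/-- The reference tetrahedron in terms of its facet inequalities, grouped so that its sections
by the planes `x₃ = const` are visibly rectangles. -/
theorem mem_Tref_iff (x : Fin 3 → ℝ) :
    x ∈ Tref ↔ |x 0 + x 1| ≤ 1 + x 2 ∧ |x 0 - x 1| ≤ 1 - x 2 := by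
  simp only [abs_le]
  constructor
  · intro hx
    let S : Set (Fin 3 → ℝ) := {y | (-(1 + y 2) ≤ y 0 + y 1 ∧ y 0 + y 1 ≤ 1 + y 2) ∧
      -(1 - y 2) ≤ y 0 - y 1 ∧ y 0 - y 1 ≤ 1 - y 2}
    have hS : Convex ℝ S := by
      rintro y ⟨⟨hy₁, hy₂⟩, hy₃, hy₄⟩ z ⟨⟨hz₁, hz₂⟩, hz₃, hz₄⟩ a b ha hb hab
      obtain rfl : b = 1 - a := by linarith
      simp only [S, Set.mem_ofPred_eq, Pi.add_apply, Pi.smul_apply, smul_eq_mul]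
      refine ⟨⟨?_, ?_⟩, ?_, ?_⟩ <;> nlinarith
    have hsub : Set.range tverts ⊆ S := by
      rintro _ ⟨i, rfl⟩
      fin_cases i <;> simp [S, tverts] <;> norm_num
    exact convexHull_min hsub hS hx
  · rintro ⟨⟨h₁, h₂⟩, h₃, h₄⟩
    have hsum := (convex_convexHull ℝ (Set.range tverts)).sum_mem
      (t := Finset.univ) (z := tverts)
      (w := ![(1 + x 0 + x 1 + x 2) / 4, (1 + x 0 - x 1 - x 2) / 4,
        (1 - x 0 + x 1 - x 2) / 4, (1 - x 0 - x 1 + x 2) / 4])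
      (by intro i _; fin_cases i <;> simp <;> linarith)
      (by simp [Fin.sum_univ_four]; ring)
      (fun i _ => subset_convexHull ℝ _ (Set.mem_range_self i))
    refine Eq.subst (motive := (· ∈ Tref)) ?_ hsum
    ext j
    fin_cases j <;> simp [Fin.sum_univ_four, tverts] <;> ring

theorem isCompact_Tref : IsCompact Tref :=
  (Set.finite_range tverts).isCompact_convexHull ℝ

theorem measurableSet_Tref : MeasurableSet Tref :=
  isCompact_Tref.measurableSet

theorem volume_setOf_abs_le_and_abs_le :
    volume {y : Fin 3 → ℝ | |y 1| ≤ 1 + y 0 ∧ |y 2| ≤ 1 - y 0} = ENNReal.ofReal (16 / 3) := by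
  have hmeas : MeasurableSet {p : ℝ × (Fin 2 → ℝ) | |p.2 0| ≤ 1 + p.1 ∧ |p.2 1| ≤ 1 - p.1} :=
    (measurableSet_le (f := fun p : ℝ × (Fin 2 → ℝ) => |p.2 0|) (g := fun p => 1 + p.1)
      (by fun_prop) (by fun_prop)).inter
    (measurableSet_le (f := fun p : ℝ × (Fin 2 → ℝ) => |p.2 1|) (g := fun p => 1 - p.1)
      (by fun_prop) (by fun_prop))
  have hslice (t : ℝ) :
      Prod.mk t ⁻¹' {p : ℝ × (Fin 2 → ℝ) | |p.2 0| ≤ 1 + p.1 ∧ |p.2 1| ≤ 1 - p.1} =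
        Set.Icc ![-(1 + t), -(1 - t)] ![1 + t, 1 - t] := by
    ext y
    simp only [Set.mem_preimage, Set.mem_ofPred_eq, abs_le, Set.mem_Icc, Pi.le_def,
      Fin.forall_fin_two, Matrix.cons_val_zero, Matrix.cons_val_one]
    tauto
  have harea (t : ℝ) : volume (Set.Icc ![-(1 + t), -(1 - t)] ![1 + t, 1 - t]) =
      (Set.Icc (-1) 1).indicator (fun t : ℝ => ENNReal.ofReal (4 * (1 - t ^ 2))) t := by
    rw [Real.volume_Icc_pi]
    simp only [Fin.prod_univ_two, Matrix.cons_val_zero, Matrix.cons_val_one]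
    by_cases ht : t ∈ Set.Icc (-1 : ℝ) 1
    · rw [Set.indicator_of_mem ht, ← ENNReal.ofReal_mul (by linarith [ht.1])]
      ring_nf
    · rw [Set.indicator_of_notMem ht, mul_eq_zero, ENNReal.ofReal_eq_zero,
        ENNReal.ofReal_eq_zero]
      rw [Set.mem_Icc, not_and_or, not_le, not_le] at ht
      exact ht.imp (fun h => by linarith) (fun h => by linarith)
  have hint : ∫ t in Set.Icc (-1 : ℝ) 1, 4 * (1 - t ^ 2) = 16 / 3 := by
    rw [integral_Icc_eq_integral_Ioc, ← intervalIntegral.integral_of_le (by norm_num)]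
    rw [intervalIntegral.integral_const_mul, intervalIntegral.integral_sub (by simp) (by simp)]
    simp [integral_pow]
    norm_num
  calc
    _ = volume (MeasurableEquiv.piFinSuccAbove (fun _ : Fin 3 => ℝ) 0 ⁻¹'
          {p : ℝ × (Fin 2 → ℝ) | |p.2 0| ≤ 1 + p.1 ∧ |p.2 1| ≤ 1 - p.1}) := rfl
    _ = volume {p : ℝ × (Fin 2 → ℝ) | |p.2 0| ≤ 1 + p.1 ∧ |p.2 1| ≤ 1 - p.1} :=
      (volume_preserving_piFinSuccAbove (fun _ : Fin 3 => ℝ) 0).measure_preimage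
        hmeas.nullMeasurableSet
    _ = ∫⁻ t in Set.Icc (-1 : ℝ) 1, ENNReal.ofReal (4 * (1 - t ^ 2)) := by
      rw [Measure.volume_eq_prod, Measure.prod_apply hmeas,
        ← lintegral_indicator measurableSet_Icc]
      simp_rw [hslice, harea]
    _ = ENNReal.ofReal (16 / 3) := by
      rw [← ofReal_integral_eq_lintegral_ofReal, hint]
      · exact (by fun_prop : Continuous fun t : ℝ => 4 * (1 - t ^ 2)).integrableOn_Icc
      · filter_upwards [ae_restrict_mem measurableSet_Icc] with t ht
        exact mul_nonneg (by norm_num) (by nlinarith [ht.1, ht.2])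

theorem volume_Tref : volume Tref = ENNReal.ofReal (8 / 3) := by
  let M : Matrix (Fin 3) (Fin 3) ℝ := !![0, 0, 1; 1, 1, 0; 1, -1, 0]
  have hM : LinearMap.det (Matrix.toLin' M) = -2 := by
    rw [LinearMap.det_toLin']
    simp [M, Matrix.det_fin_three]
    norm_num
  have hpre : Tref = Matrix.toLin' M ⁻¹'
      {y : Fin 3 → ℝ | |y 1| ≤ 1 + y 0 ∧ |y 2| ≤ 1 - y 0} := by
    ext x
    rw [mem_Tref_iff]
    simp [M, Matrix.mulVec, dotProduct, Fin.sum_univ_three, sub_eq_add_neg]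
  rw [hpre, Measure.addHaar_preimage_linearMap _ (by rw [hM]; norm_num), hM,
    volume_setOf_abs_le_and_abs_le, ← ENNReal.ofReal_mul (abs_nonneg _)]
  norm_num [abs_of_neg]

/-- A function which is odd under a linear symmetry of a set has vanishing integral on it. -/
theorem setIntegral_eq_zero_of_mulVec_eq_neg {n : Type*} [Fintype n] [DecidableEq n]
    {s : Set (n → ℝ)} (hs : MeasurableSet s) (B : Matrix n n ℝ) (hB : B * B = 1)
    (hmem : ∀ x ∈ s, B.mulVec x ∈ s) {f : (n → ℝ) → ℝ} (hf : ∀ x, f (B.mulVec x) = -f x) :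
    ∫ x in s, f x = 0 := by
  have hdet : B.det * B.det = 1 := by rw [← Matrix.det_mul, hB, Matrix.det_one]
  have himage : (fun x => B.mulVec x + 0) '' s = s := by
    refine Set.Subset.antisymm ?_ fun x hx => ⟨B.mulVec x, hmem x hx, ?_⟩
    · rintro _ ⟨x, hx, rfl⟩
      simpa using hmem x hx
    · simp [Matrix.mulVec_mulVec, hB]
  have h := setIntegral_image_mulVec_add B (IsUnit.of_mul_eq_one _ hdet) 0 hs f
  have habs : |B.det| = 1 := by
    rcases mul_self_eq_one_iff.1 hdet with h | h <;> simp [h]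
  rw [himage] at h
  simp only [add_zero, hf, integral_neg, habs, one_mul] at h
  linarith

theorem continuous_basisFuns (i : Fin 6) : Continuous (basisFuns i) := by
  fin_cases i <;> simp only [basisFuns] <;> dsimp <;> fun_prop

theorem setIntegral_Tref_basisFuns (i : Fin 6) :
    ∫ x in Tref, basisFuns i x = 4 / 9 * ∑ j, basisFuns i (pts j) := by
  have hcoord : ∀ x ∈ Tref, ![-x 0, -x 1, x 2] ∈ Tref ∧ ![x 0, -x 1, -x 2] ∈ Tref ∧
      ![x 1, x 0, x 2] ∈ Tref ∧ ![x 0, x 2, x 1] ∈ Tref := by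
    intro x hx
    simp only [mem_Tref_iff, abs_le] at hx ⊢
    simp
    refine ⟨?_, ?_, ?_, ?_⟩ <;> constructor <;> constructor <;> linarith
  have hneg₀₁ (x : Fin 3 → ℝ) :
      (!![-1, 0, 0; 0, -1, 0; 0, 0, 1] : Matrix (Fin 3) (Fin 3) ℝ).mulVec x =
        ![-x 0, -x 1, x 2] := by
    ext j; fin_cases j <;> simp [Matrix.mulVec, dotProduct, Fin.sum_univ_three]
  have hneg₁₂ (x : Fin 3 → ℝ) :
      (!![1, 0, 0; 0, -1, 0; 0, 0, -1] : Matrix (Fin 3) (Fin 3) ℝ).mulVec x =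
        ![x 0, -x 1, -x 2] := by
    ext j; fin_cases j <;> simp [Matrix.mulVec, dotProduct, Fin.sum_univ_three]
  have hswap₀₁ (x : Fin 3 → ℝ) :
      (!![0, 1, 0; 1, 0, 0; 0, 0, 1] : Matrix (Fin 3) (Fin 3) ℝ).mulVec x =
        ![x 1, x 0, x 2] := by
    ext j; fin_cases j <;> simp [Matrix.mulVec, dotProduct, Fin.sum_univ_three]
  have hswap₁₂ (x : Fin 3 → ℝ) :
      (!![1, 0, 0; 0, 0, 1; 0, 1, 0] : Matrix (Fin 3) (Fin 3) ℝ).mulVec x =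
        ![x 0, x 2, x 1] := by
    ext j; fin_cases j <;> simp [Matrix.mulVec, dotProduct, Fin.sum_univ_three]
  have key (B : Matrix (Fin 3) (Fin 3) ℝ) (g : (Fin 3 → ℝ) → Fin 3 → ℝ)
      (hg : ∀ x, B.mulVec x = g x) (hB : ∀ x, g (g x) = x) (hmem : ∀ x ∈ Tref, g x ∈ Tref)
      (hf : ∀ x, basisFuns i (g x) = -basisFuns i x)
      (hsum : ∑ j, basisFuns i (pts j) = 0) :
      ∫ x in Tref, basisFuns i x = 4 / 9 * ∑ j, basisFuns i (pts j) := by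
    have hBB : B * B = 1 := Matrix.mulVec_injective (funext fun x => by
      rw [← Matrix.mulVec_mulVec, hg, hg, hB, Matrix.one_mulVec])
    simp only [← hg] at hmem hf
    rw [setIntegral_eq_zero_of_mulVec_eq_neg measurableSet_Tref B hBB hmem hf, hsum, mul_zero]
  have eta (x : Fin 3 → ℝ) : ![x 0, x 1, x 2] = x := by ext j; fin_cases j <;> rfl
  fin_cases i
  · simp [basisFuns, Measure.real, volume_Tref]
    norm_num
  · exact key _ _ hneg₀₁ (by simp [eta]) (fun x hx => (hcoord x hx).1)
      (by simp [basisFuns]) (by simp [basisFuns, pts, Fin.sum_univ_six])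
  · exact key _ _ hneg₀₁ (by simp [eta]) (fun x hx => (hcoord x hx).1)
      (by simp [basisFuns]) (by simp [basisFuns, pts, Fin.sum_univ_six])
  · exact key _ _ hneg₁₂ (by simp [eta]) (fun x hx => (hcoord x hx).2.1)
      (by simp [basisFuns]) (by simp [basisFuns, pts, Fin.sum_univ_six])
  · exact key _ _ hswap₀₁ (by simp [eta]) (fun x hx => (hcoord x hx).2.2.1)
      (by simp [basisFuns]) (by simp [basisFuns, pts, Fin.sum_univ_six])
  · exact key _ _ hswap₁₂ (by simp [eta]) (fun x hx => (hcoord x hx).2.2.2)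
      (by simp [basisFuns]) (by simp [basisFuns, pts, Fin.sum_univ_six])

theorem integrableOn_and_setIntegral_Tref_of_mem_VK {f : (Fin 3 → ℝ) → ℝ} (hf : f ∈ VK) :
    IntegrableOn f Tref ∧ ∫ x in Tref, f x = 4 / 9 * ∑ j, f (pts j) := by
  induction hf using Submodule.span_induction with
  | mem f hf =>
    obtain ⟨i, rfl⟩ := hf
    exact ⟨(continuous_basisFuns i).continuousOn.integrableOn_compact isCompact_Tref,
      setIntegral_Tref_basisFuns i⟩
  | zero => simp [IntegrableOn]
  | add f g _ _ hf hg =>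
    refine ⟨hf.1.add hg.1, ?_⟩
    simp only [Pi.add_apply, Finset.sum_add_distrib, mul_add]
    rw [integral_add hf.1 hg.1, hf.2, hg.2]
  | smul a f _ hf =>
    refine ⟨hf.1.smul a, ?_⟩
    simp only [Pi.smul_apply, smul_eq_mul, integral_const_mul, hf.2, ← Finset.mul_sum]
    ring

/-- Edge-midpoint quadrature is exact for rotated-`Q₁` functions on any affinely mapped
tetrahedron `T = F(T̂)`, `F(x̂) = Ax̂ + c` with `A` invertible: for `w` with `w ∘ F ∈ V(K̂)`,
`∫_T w = (|T|/6) Σᵢ w(F(xᵢ))`, where `|T| = |det A|·(8/3)`. -/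
theorem midpoint_quadrature_rotatedQ1 (A : Matrix (Fin 3) (Fin 3) ℝ) (hA : IsUnit A.det)
    (c : Fin 3 → ℝ) (w : (Fin 3 → ℝ) → ℝ)
    (hw : (fun x => w (A.mulVec x + c)) ∈ VK) :
    volume ((fun x => A.mulVec x + c) '' Tref) = ENNReal.ofReal (|A.det| * (8 / 3)) ∧
    ∫ x in (fun x => A.mulVec x + c) '' Tref, w x ∂volume
      = (volume ((fun x => A.mulVec x + c) '' Tref)).toReal / 6 *
          ∑ i : Fin 6, w (A.mulVec (pts i) + c) := by
  have hvol : volume ((fun x => A.mulVec x + c) '' Tref) =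
      ENNReal.ofReal (|A.det| * (8 / 3)) := by
    rw [volume_image_mulVec_add, volume_Tref, ← ENNReal.ofReal_mul (abs_nonneg _)]
  refine ⟨hvol, ?_⟩
  rw [setIntegral_image_mulVec_add A hA c measurableSet_Tref,
    (integrableOn_and_setIntegral_Tref_of_mem_VK hw).2, hvol,
    ENNReal.toReal_ofReal (by positivity)]
  ring

end
end
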